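/- Let A be a C*-algebra and let p, q ∈ A be projections. Then the following are equivalent: (i) p is Cuntz subequivalent to q, i.e. for every ε > 0 there exists x ∈ A with ‖x·q·x* − p‖ < ε; (ii) p is Murray–von Neumann equivalent to a subprojection of q, i.e. there exists v ∈ A with v*v = p and q·(v·v*) = v·v* (that is, the projection vv* satisfies vv* ≤ q). -/

import Mathlib

theorem aux_inv_sqrt {A : Type*} [CStarAlgebra A] (b p : A) (hb : IsSelfAdjoint b)
    (h : ‖b - 1‖ < 1) (hc : Commute b p) :
    ∃ w : A, star w = w ∧ w * b * w = 1 ∧ Commute w p := by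
  rcases subsingleton_or_nontrivial A with hs | hs
  · exact ⟨0, Subsingleton.elim _ _, Subsingleton.elim _ _, Subsingleton.elim _ _⟩
  have hpos : ∀ t ∈ spectrum ℝ b, 0 < t := by
    intro t ht
    have h1 : t - 1 ∈ spectrum ℝ (b - 1) := by
      have := spectrum.sub_singleton_eq b (1 : ℝ)
      rw [map_one] at this
      rw [← this]
      exact ⟨t, ht, 1, rfl, rfl⟩
    have h2 := spectrum.norm_le_norm_of_mem h1
    rw [Real.norm_eq_abs] at h2
    have := (abs_lt.1 (h2.trans_lt h)).1
    linarith
  have hf : ContinuousOn (fun t : ℝ => (Real.sqrt t)⁻¹) (spectrum ℝ b) :=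
    Real.continuous_sqrt.continuousOn.inv₀ fun t ht => (Real.sqrt_pos.2 (hpos t ht)).ne'
  refine ⟨cfc (fun t : ℝ => (Real.sqrt t)⁻¹) b, ?_, ?_, ?_⟩
  · exact (cfc_predicate (fun t : ℝ => (Real.sqrt t)⁻¹) b : IsSelfAdjoint _)
  · nth_rw 2 [← cfc_id ℝ b]
    rw [← cfc_mul _ _ b hf continuousOn_id,
      ← cfc_mul (fun t : ℝ => (Real.sqrt t)⁻¹ * id t) _ b (hf.mul continuousOn_id) hf, ← cfc_one ℝ b]
    refine cfc_congr fun t ht => ?_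
    have h0 := Real.sqrt_pos.2 (hpos t ht)
    have h1 := Real.mul_self_sqrt (hpos t ht).le
    simp only [id, Pi.one_apply]
    field_simp
    nlinarith
  · exact hb.commute_cfc hc _

theorem aux_main {A : Type*} [CStarAlgebra A]
    (p q : A) (hp₁ : p = star p) (hp₂ : p * p = p)
    (hq₁ : q = star q) (hq₂ : q * q = q) :
    (∀ ε > (0 : ℝ), ∃ x : A, ‖x * q * star x - p‖ < ε) ↔
      ∃ v : A, star v * v = p ∧ q * (v * star v) = v * star v := by
  constructor
  · intro h
    obtain ⟨x, hx⟩ := h 1 one_pos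
    have hpn : ‖p‖ ≤ 1 := by
      have h1 : ‖p‖ = ‖p‖ * ‖p‖ := by
        have := CStarRing.norm_star_mul_self (x := p)
        rwa [← hp₁, hp₂] at this
      nlinarith [norm_nonneg p, sq_nonneg (‖p‖ - 1)]
    set b : A := p * (x * q * star x) * p + (1 - p) with hbdef
    have hb : IsSelfAdjoint b := by
      simp [IsSelfAdjoint, hbdef, ← hp₁, ← hq₁, mul_assoc]
    have hpb : p * b = p * (x * q * star x) * p := by
      simp [hbdef, mul_add, mul_sub, ← mul_assoc, hp₂]
    have hbp : b * p = p * (x * q * star x) * p := by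
      simp [hbdef, add_mul, sub_mul, mul_assoc, hp₂]
    have hn : ‖b - 1‖ < 1 := by
      have e : b - 1 = p * (x * q * star x - p) * p := by
        simp only [mul_sub, sub_mul, hp₂, hbdef]; abel
      rw [e]
      calc _ ≤ ‖p‖ * ‖x * q * star x - p‖ * ‖p‖ :=
            (norm_mul_le _ _).trans (by gcongr; exact norm_mul_le _ _)
        _ ≤ 1 * ‖x * q * star x - p‖ * 1 := by gcongr
        _ < 1 := by simpa using hx
    obtain ⟨w, hw, hwb, hwp⟩ := aux_inv_sqrt b p hb hn (hbp.trans hpb.symm)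
    refine ⟨q * star x * p * w, ?_, ?_⟩
    · have : star (q * star x * p * w) * (q * star x * p * w)
          = w * (p * (x * (q * q) * star x) * p) * w := by
        simp only [star_mul, star_star, hw, ← hp₁, ← hq₁, mul_assoc]
      rw [this, hq₂, ← hpb, ← mul_assoc, hwp.eq, mul_assoc, mul_assoc, ← mul_assoc w, hwb, mul_one]
    · simp only [← mul_assoc, hq₂]
  · rintro ⟨v, hv, hqv⟩ ε hε
    have h1 : (v * star v) * q = v * star v := by
      have := congrArg star hqv
      simpa [← hq₁] using this
    have h2 : q * v - v = 0 := by
      rw [← CStarRing.mul_star_self_eq_zero_iff]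
      have : (q * v - v) * star (q * v - v)
          = (q * (v * star v)) * q - q * (v * star v) - (v * star v) * q + v * star v := by
        rw [star_sub, star_mul, ← hq₁]; noncomm_ring
      rw [this, hqv, h1]; abel
    refine ⟨star v, ?_⟩
    rw [star_star, mul_assoc, sub_eq_zero.1 h2, hv, sub_self, norm_zero]
    exact hε

/-- For projections `p, q` in a C*-algebra, `p` is Cuntz subequivalent to `q` if and
only if `p` is Murray–von Neumann equivalent to a subprojection of `q`. -/
theorem projection_cuntz_subequivalent_iff_mvN_subprojection
    (A : Type*) [NormedRing A] [StarRing A] [CStarRing A] [CompleteSpace A]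
    [NormedAlgebra ℂ A] [StarModule ℂ A]
    (p q : A) (hp₁ : p = star p) (hp₂ : p * p = p)
    (hq₁ : q = star q) (hq₂ : q * q = q) :
    (∀ ε > (0 : ℝ), ∃ x : A, ‖x * q * star x - p‖ < ε) ↔
      ∃ v : A, star v * v = p ∧ q * (v * star v) = v * star v := by
  letI : CStarAlgebra A := { }
  exact aux_main p q hp₁ hp₂ hq₁ hq₂
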